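/- (No anomaly zone for the balanced rooted quartet, algebraic core of Theorem 2.) With the balanced-tree gene-tree class probabilities h1, h2, h3, h4, h5 defined below for an integer n ≥ 1, if 1/n ≤ x ≤ 1 and 1/n ≤ y ≤ 1, then h1 ≥ h2, h1 ≥ h3, h1 ≥ h4, and h1 ≥ h5; that is, the class probability of the species-tree topology is maximal among all five gene-tree topology classes. -/

import Mathlib

/-- `D(n)` from the paper: `(C(n,2) − 2(n−1) + 1)/C(n,2)` for `n ≥ 4`, and `0` otherwise. -/
noncomputable def Dbal (n : ℕ) : ℝ :=
  if 4 ≤ n then ((n : ℝ) * ((n : ℝ) - 1) / 2 - 2 * ((n : ℝ) - 1) + 1) /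
    ((n : ℝ) * ((n : ℝ) - 1) / 2) else 0

/-- Probability of the species-tree (balanced) gene-tree topology class. -/
noncomputable def h1 (n : ℕ) (x y : ℝ) : ℝ :=
  x * y + (x * (1 - y) + (1 - x) * y) * (((n : ℝ) - 2) / (3 * (n : ℝ))) *
    (if 3 ≤ n then 1 else 0) + (1 - x) * (1 - y) * Dbal n / 9

/-- Probability of either alternative balanced gene-tree topology. -/
noncomputable def h2 (n : ℕ) (x y : ℝ) : ℝ :=
  (1 - x) * (1 - y) * ((2 * (n : ℝ) - 1) / (3 * (n : ℝ) * ((n : ℝ) - 1)) *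
    (if 2 ≤ n then 1 else 0) + Dbal n / 9)

/-- Probability of a caterpillar gene-tree topology with cherry `{a,b}`. -/
noncomputable def h3 (n : ℕ) (x y : ℝ) : ℝ :=
  x * (1 - y) * ((1 / (n : ℝ)) * (if 2 ≤ n then 1 else 0) +
    (((n : ℝ) - 2) / (3 * (n : ℝ))) * (if 3 ≤ n then 1 else 0)) +
    (1 - x) * (1 - y) * Dbal n / 18

/-- Probability of a caterpillar gene-tree topology with cherry `{c,d}`. -/
noncomputable def h4 (n : ℕ) (x y : ℝ) : ℝ :=
  (1 - x) * y * ((1 / (n : ℝ)) * (if 2 ≤ n then 1 else 0) +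
    (((n : ℝ) - 2) / (3 * (n : ℝ))) * (if 3 ≤ n then 1 else 0)) +
    (1 - x) * (1 - y) * Dbal n / 18

/-- Probability of any of the remaining caterpillar gene-tree topologies. -/
noncomputable def h5 (n : ℕ) (x y : ℝ) : ℝ :=
  (1 - x) * (1 - y) * ((((n : ℝ) - 2) / (3 * (n : ℝ) * ((n : ℝ) - 1))) *
    (if 3 ≤ n then 1 else 0) + Dbal n / 18)

lemma Dbal_nonneg' (n : ℕ) : 0 ≤ Dbal n := by
  unfold Dbal
  split_ifs with h
  · have h4 : (4 : ℝ) ≤ n := by exact_mod_cast h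
    apply div_nonneg <;> nlinarith
  · exact le_refl _

/-- Algebraic core of Theorem 2: no anomaly zone for the balanced rooted quartet. -/
theorem balanced_no_anomaly (n : ℕ) (hn : 1 ≤ n) (x y : ℝ)
    (hx1 : 1 / (n : ℝ) ≤ x) (hx2 : x ≤ 1)
    (hy1 : 1 / (n : ℝ) ≤ y) (hy2 : y ≤ 1) :
    h1 n x y ≥ h2 n x y ∧ h1 n x y ≥ h3 n x y ∧
      h1 n x y ≥ h4 n x y ∧ h1 n x y ≥ h5 n x y := by
  have hD := Dbal_nonneg' n
  rcases Nat.lt_or_ge n 2 with h | h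
  · have h1' : n = 1 := by omega
    subst h1'
    have ex : x = 1 := by norm_num at hx1; linarith
    have ey : y = 1 := by norm_num at hy1; linarith
    subst ex
    subst ey
    norm_num [h1, h2, h3, h4, h5]
  · have hn2 : (2 : ℝ) ≤ n := by exact_mod_cast h
    have hn0 : (0 : ℝ) < n := by linarith
    have hm0 : (0 : ℝ) < (n : ℝ) - 1 := by linarith
    obtain ⟨t, ht⟩ : ∃ t : ℝ, t = ((n : ℝ) - 2) / (3 * (n : ℝ)) := ⟨_, rfl⟩
    obtain ⟨r, hr⟩ : ∃ r : ℝ, r = 1 / (n : ℝ) := ⟨_, rfl⟩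
    obtain ⟨k, hk⟩ : ∃ k : ℝ, k = 1 / ((n : ℝ) - 1) := ⟨_, rfl⟩
    have ht0 : 0 ≤ t := by rw [ht]; apply div_nonneg <;> linarith
    have hr0 : 0 < r := by rw [hr]; positivity
    have hk0 : 0 < k := by rw [hk]; positivity
    have e1 : ((n : ℝ) - 2) / (3 * (n : ℝ)) * (if 3 ≤ n then 1 else 0) = t := by
      split_ifs with h3
      · rw [ht, mul_one]
      · have : n = 2 := by omega
        subst this
        norm_num [ht]
    have e2 : ((n : ℝ) - 2) / (3 * (n : ℝ) * ((n : ℝ) - 1)) * (if 3 ≤ n then 1 else 0)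
        = t * k := by
      rw [← e1, hk]
      field_simp
    have e3 : (2 * (n : ℝ) - 1) / (3 * (n : ℝ) * ((n : ℝ) - 1)) = 2 * (t * k) + r * k := by
      rw [ht, hk, hr]
      field_simp
      ring
    have key : ∀ z : ℝ, 1 / (n : ℝ) ≤ z → (1 - z) * k ≤ z := by
      intro z hz
      rw [div_le_iff₀ hn0] at hz
      rw [hk, mul_one_div, div_le_iff₀ hm0]
      linarith
    have kx := key x hx1
    have ky := key y hy1
    rw [← hr] at hx1 hy1
    have x0 : 0 < x := by linarith
    have y0 : 0 < y := by linarith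
    obtain ⟨p, hp⟩ : ∃ p : ℝ, p = 1 - x := ⟨_, rfl⟩
    obtain ⟨q, hq⟩ : ∃ q : ℝ, q = 1 - y := ⟨_, rfl⟩
    have p0 : 0 ≤ p := by linarith
    have q0 : 0 ≤ q := by linarith
    have q1 : q ≤ 1 := by linarith
    have p1 : p ≤ 1 := by linarith
    unfold h1 h2 h3 h4 h5
    rw [mul_assoc (x * (1 - y) + (1 - x) * y), e1, e2, e3, if_pos h, ← hr, ← hp, ← hq]
    rw [← hp] at kx
    rw [← hq] at ky
    have a1 : t * (q * (p * k)) ≤ t * (q * x) := by gcongr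
    have a2 : t * (p * (q * k)) ≤ t * (p * y) := by gcongr
    have a3 : r * (q * (p * k)) ≤ y * (1 * x) := by gcongr
    have a4 : x * q * r ≤ x * 1 * y := by gcongr
    have a5 : y * p * r ≤ y * 1 * x := by gcongr
    have b1 : 0 ≤ t * (q * x) := by positivity
    have b2 : 0 ≤ t * (p * y) := by positivity
    have b3 : 0 ≤ x * y := by positivity
    have b4 : 0 ≤ p * q * Dbal n := by positivity
    refine ⟨?_, ?_, ?_, ?_⟩ <;> nlinarith
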